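/- arXiv:math/0208122 — 11 statements merged into one kernel-verified Lean document; each statement's English description precedes it below -/
import Mathlib

section
/- Let γ be a cointegral on C. Then the cointegral product on C is associative: for all c, c', c'' ∈ C, (c * c') * c'' = c * (c' * c''). -/
open TensorProduct

variable {A C : Type*} [CommRing A] [AddCommGroup C] [Module A C] [Coalgebra A C]

/-- The cointegral product as a linear map `C ⊗[A] C →ₗ[A] C`;
on simple tensors, `c ⊗ c' ↦ Σ γ(c ⊗ c'₍₁₎) • c'₍₂₎`. -/
noncomputable def cointMulL (γ : C ⊗[A] C →ₗ[A] A) : C ⊗[A] C →ₗ[A] C :=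
  (TensorProduct.lid A C).toLinearMap
    ∘ₗ LinearMap.rTensor C γ
    ∘ₗ (TensorProduct.assoc A C C C).symm.toLinearMap
    ∘ₗ LinearMap.lTensor C Coalgebra.comul

/-- The alternative expression of the cointegral product;
on simple tensors, `c ⊗ c' ↦ Σ γ(c₍₂₎ ⊗ c') • c₍₁₎`. -/
noncomputable def cointMulR (γ : C ⊗[A] C →ₗ[A] A) : C ⊗[A] C →ₗ[A] C :=
  (TensorProduct.rid A C).toLinearMap
    ∘ₗ LinearMap.lTensor C γ
    ∘ₗ (TensorProduct.assoc A C C C).toLinearMap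
    ∘ₗ LinearMap.rTensor C Coalgebra.comul

theorem cointMulL_repr (γ : C ⊗[A] C →ₗ[A] A) (c d : C) {ι : Type*} (r : Coalgebra.Repr A d ι) :
    cointMulL γ (c ⊗ₜ[A] d) = ∑ i ∈ r.index, γ (c ⊗ₜ[A] r.left i) • r.right i := by
  simp [cointMulL, ← r.eq, TensorProduct.tmul_sum, map_sum]

theorem cointMulR_repr (γ : C ⊗[A] C →ₗ[A] A) (c d : C) {ι : Type*} (r : Coalgebra.Repr A c ι) :
    cointMulR γ (c ⊗ₜ[A] d) = ∑ i ∈ r.index, γ (r.right i ⊗ₜ[A] d) • r.left i := by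
  simp [cointMulR, ← r.eq, TensorProduct.sum_tmul, map_sum]

theorem cointMulL_balanced (γ : C ⊗[A] C →ₗ[A] A)
    (hcol : ∀ c c' : C, cointMulL γ (c ⊗ₜ[A] c') = cointMulR γ (c ⊗ₜ[A] c')) (c c' d : C) :
    γ (cointMulL γ (c ⊗ₜ[A] c') ⊗ₜ[A] d) = γ (c ⊗ₜ[A] cointMulL γ (c' ⊗ₜ[A] d)) := by
  have r := Coalgebra.Repr.arbitrary A c'
  rw [hcol c' d, cointMulL_repr γ c c' r, cointMulR_repr γ c' d r]
  simp only [TensorProduct.sum_tmul, TensorProduct.tmul_sum, map_sum,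
    TensorProduct.tmul_smul, ← TensorProduct.smul_tmul', map_smul, smul_eq_mul]
  exact Finset.sum_congr rfl fun i _ => mul_comm _ _

theorem comul_cointMulL (γ : C ⊗[A] C →ₗ[A] A) (c d : C) {ι : Type*} (r : Coalgebra.Repr A d ι) :
    Coalgebra.comul (R := A) (cointMulL γ (c ⊗ₜ[A] d)) =
      ∑ i ∈ r.index, cointMulL γ (c ⊗ₜ[A] r.left i) ⊗ₜ[A] r.right i := by
  have h := congrArg (fun t => TensorProduct.lid A (C ⊗[A] C)
    (LinearMap.rTensor (C ⊗[A] C) (γ ∘ₗ TensorProduct.mk A C C c) t)) (Coalgebra.coassoc_apply (R := A) d)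
  rw [← r.eq] at h
  simp only [map_sum, LinearMap.rTensor_tmul, LinearMap.lTensor_tmul, TensorProduct.lid_tmul,
    LinearMap.comp_apply, TensorProduct.mk_apply] at h
  rw [cointMulL_repr γ c d r, map_sum]
  simp only [map_smul]
  rw [← h]
  refine Finset.sum_congr rfl fun i _ => ?_
  have q := Coalgebra.Repr.arbitrary A (r.left i)
  rw [cointMulL_repr γ c _ q, ← q.eq]
  simp [TensorProduct.sum_tmul, map_sum, TensorProduct.smul_tmul']

/-- the cointegral product is associative. -/
theorem cointMul_assoc (γ : C ⊗[A] C →ₗ[A] A)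
    (hcol : ∀ c c' : C, cointMulL γ (c ⊗ₜ[A] c') = cointMulR γ (c ⊗ₜ[A] c'))
    (hnorm : ∀ c : C, γ (Coalgebra.comul c) = Coalgebra.counit c) :
    ∀ c c' c'' : C,
      cointMulL γ ((cointMulL γ (c ⊗ₜ[A] c')) ⊗ₜ[A] c'') =
        cointMulL γ (c ⊗ₜ[A] (cointMulL γ (c' ⊗ₜ[A] c''))) := by
  intro c c' c''
  have r := Coalgebra.Repr.arbitrary A c''
  have h : cointMulL γ (c ⊗ₜ[A] (cointMulL γ (c' ⊗ₜ[A] c''))) =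
      ∑ i ∈ r.index, γ (c ⊗ₜ[A] cointMulL γ (c' ⊗ₜ[A] r.left i)) • r.right i := by
    have key : ∀ x : C, cointMulL γ (c ⊗ₜ[A] x) = TensorProduct.lid A C (LinearMap.rTensor C γ
        ((TensorProduct.assoc A C C C).symm (c ⊗ₜ[A] Coalgebra.comul x))) := fun _ => rfl
    rw [key]
    simp [comul_cointMulL γ c' c'' r, TensorProduct.tmul_sum, map_sum]
  rw [h, cointMulL_repr γ _ c'' r]
  simp only [cointMulL_balanced γ hcol]
end

section
/- Let γ be a cointegral on C. Then the comultiplication Δ is a two-sided module map for the cointegral product: for all c, c' ∈ C, Δ(c * c') = Σ (c * c'₍₁₎) ⊗ c'₍₂₎ and Δ(c * c') = Σ c₍₁₎ ⊗ (c₍₂₎ * c'). (Equivalently, the induced product map π : C ⊗[A] C → C, π(c ⊗ c') = c * c', is a (C,C)-bicomodule map.) -/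
open TensorProduct

variable {A C : Type*} [CommRing A] [AddCommGroup C] [Module A C] [Coalgebra A C]

theorem cointMulL_eq (γ : C ⊗[A] C →ₗ[A] A) (c x : C) :
    cointMulL γ (c ⊗ₜ[A] x) = TensorProduct.lid A C
      (LinearMap.rTensor C (γ ∘ₗ TensorProduct.mk A C C c) (Coalgebra.comul x)) := by
  have key : ∀ t : C ⊗[A] C,
      TensorProduct.lid A C (LinearMap.rTensor C γ
        ((TensorProduct.assoc A C C C).symm (c ⊗ₜ[A] t))) =
      TensorProduct.lid A C (LinearMap.rTensor C (γ ∘ₗ TensorProduct.mk A C C c) t) := by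
    intro t
    induction t with
    | zero => simp
    | tmul a b => simp
    | add a b ha hb => simp only [TensorProduct.tmul_add, map_add, ha, hb]
  simpa [cointMulL] using key (Coalgebra.comul x)

theorem cointMulR_eq (γ : C ⊗[A] C →ₗ[A] A) (x c : C) :
    cointMulR γ (x ⊗ₜ[A] c) = TensorProduct.rid A C
      (LinearMap.lTensor C (γ ∘ₗ (TensorProduct.mk A C C).flip c) (Coalgebra.comul x)) := by
  have key : ∀ t : C ⊗[A] C,
      TensorProduct.rid A C (LinearMap.lTensor C γ
        ((TensorProduct.assoc A C C C) (t ⊗ₜ[A] c))) =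
      TensorProduct.rid A C
        (LinearMap.lTensor C (γ ∘ₗ (TensorProduct.mk A C C).flip c) t) := by
    intro t
    induction t with
    | zero => simp
    | tmul a b => simp
    | add a b ha hb => simp only [TensorProduct.add_tmul, map_add, ha, hb]
  simpa [cointMulR] using key (Coalgebra.comul x)

theorem comul_slice_left (φ : C →ₗ[A] A) (x : C) :
    Coalgebra.comul (R := A) (TensorProduct.lid A C (LinearMap.rTensor C φ (Coalgebra.comul x))) =
      LinearMap.rTensor C ((TensorProduct.lid A C).toLinearMap ∘ₗ LinearMap.rTensor C φ ∘ₗ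
        Coalgebra.comul) (Coalgebra.comul (R := A) x) := by
  have h1 : ∀ t : C ⊗[A] C,
      Coalgebra.comul (R := A) (TensorProduct.lid A C (LinearMap.rTensor C φ t)) =
      TensorProduct.lid A (C ⊗[A] C) (LinearMap.rTensor (C ⊗[A] C) φ
        (LinearMap.lTensor C Coalgebra.comul t)) := by
    intro t
    induction t with
    | zero => simp
    | tmul a b => simp
    | add a b ha hb => simp only [map_add, ha, hb]
  have h2 : ∀ t : (C ⊗[A] C) ⊗[A] C,
      TensorProduct.lid A (C ⊗[A] C) (LinearMap.rTensor (C ⊗[A] C) φ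
        (TensorProduct.assoc A C C C t)) =
      LinearMap.rTensor C ((TensorProduct.lid A C).toLinearMap ∘ₗ LinearMap.rTensor C φ) t := by
    intro t
    have : (TensorProduct.lid A (C ⊗[A] C)).toLinearMap ∘ₗ LinearMap.rTensor (C ⊗[A] C) φ ∘ₗ
        (TensorProduct.assoc A C C C).toLinearMap =
      LinearMap.rTensor C ((TensorProduct.lid A C).toLinearMap ∘ₗ LinearMap.rTensor C φ) := by
      apply TensorProduct.ext_threefold
      intro a b d
      simp [TensorProduct.smul_tmul']
    exact LinearMap.congr_fun this t
  rw [h1, ← Coalgebra.coassoc_apply, h2]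
  simp only [LinearMap.rTensor_comp, LinearMap.comp_apply]

theorem comul_slice_right (φ : C →ₗ[A] A) (x : C) :
    Coalgebra.comul (R := A) (TensorProduct.rid A C (LinearMap.lTensor C φ (Coalgebra.comul x))) =
      LinearMap.lTensor C ((TensorProduct.rid A C).toLinearMap ∘ₗ LinearMap.lTensor C φ ∘ₗ
        Coalgebra.comul) (Coalgebra.comul (R := A) x) := by
  have h1 : ∀ t : C ⊗[A] C,
      Coalgebra.comul (R := A) (TensorProduct.rid A C (LinearMap.lTensor C φ t)) =
      TensorProduct.rid A (C ⊗[A] C) (LinearMap.lTensor (C ⊗[A] C) φ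
        (LinearMap.rTensor C Coalgebra.comul t)) := by
    intro t
    induction t with
    | zero => simp
    | tmul a b => simp
    | add a b ha hb => simp only [map_add, ha, hb]
  have h2 : ∀ t : (C ⊗[A] C) ⊗[A] C,
      TensorProduct.rid A (C ⊗[A] C) (LinearMap.lTensor (C ⊗[A] C) φ t) =
      LinearMap.lTensor C ((TensorProduct.rid A C).toLinearMap ∘ₗ LinearMap.lTensor C φ)
        (TensorProduct.assoc A C C C t) := by
    intro t
    have : (TensorProduct.rid A (C ⊗[A] C)).toLinearMap ∘ₗ LinearMap.lTensor (C ⊗[A] C) φ =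
      LinearMap.lTensor C ((TensorProduct.rid A C).toLinearMap ∘ₗ LinearMap.lTensor C φ) ∘ₗ
        (TensorProduct.assoc A C C C).toLinearMap := by
      apply TensorProduct.ext_threefold
      intro a b d
      simp
    exact LinearMap.congr_fun this t
  rw [h1, h2, Coalgebra.coassoc_apply]
  simp only [LinearMap.lTensor_comp, LinearMap.comp_apply]

/-- the comultiplication is a two-sided module map for the
cointegral product, i.e. the product map `π = cointMulL γ` is a
`(C,C)`-bicomodule map: `Δ(c * c') = Σ (c * c'₍₁₎) ⊗ c'₍₂₎` and
`Δ(c * c') = Σ c₍₁₎ ⊗ (c₍₂₎ * c')`. -/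
theorem comul_cointMul (γ : C ⊗[A] C →ₗ[A] A)
    (hcol : ∀ c c' : C, cointMulL γ (c ⊗ₜ[A] c') = cointMulR γ (c ⊗ₜ[A] c'))
    (hnorm : ∀ c : C, γ (Coalgebra.comul c) = Coalgebra.counit c) :
    ∀ c c' : C,
      Coalgebra.comul (cointMulL γ (c ⊗ₜ[A] c')) =
        LinearMap.rTensor C (cointMulL γ)
          ((TensorProduct.assoc A C C C).symm (c ⊗ₜ[A] Coalgebra.comul c')) ∧
      Coalgebra.comul (cointMulL γ (c ⊗ₜ[A] c')) =
        LinearMap.lTensor C (cointMulL γ)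
          ((TensorProduct.assoc A C C C) (Coalgebra.comul c ⊗ₜ[A] c')) := by
  intro c c'
  constructor
  · rw [cointMulL_eq, comul_slice_left]
    generalize (Coalgebra.comul c' : C ⊗[A] C) = t
    induction t with
    | zero => simp
    | tmul a b => simp [cointMulL_eq]
    | add a b ha hb => simp only [TensorProduct.tmul_add, map_add, ha, hb]
  · rw [hcol, cointMulR_eq, comul_slice_right]
    generalize (Coalgebra.comul c : C ⊗[A] C) = t
    induction t with
    | zero => simp
    | tmul a b => simp [hcol, cointMulR_eq]
    | add a b ha hb => simp only [TensorProduct.add_tmul, map_add, ha, hb]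
end

section
/- Let γ be a cointegral on C and let (M, ρ) be a right C-comodule. Then the induced action of C on M is associative over the cointegral product: for all m ∈ M and c, c' ∈ C, (m · c) · c' = m · (c * c'). -/
open TensorProduct

variable {A C : Type*} [CommRing A] [AddCommGroup C] [Module A C] [Coalgebra A C]

variable {M : Type*} [AddCommGroup M] [Module A M]

/-- The induced action `M ⊗[A] C →ₗ[A] M` of `C` on a right `C`-comodule
`(M, ρ)`; on simple tensors, `m ⊗ c ↦ Σ m₍₀₎ • γ(m₍₁₎ ⊗ c)`. -/
noncomputable def comodAct (γ : C ⊗[A] C →ₗ[A] A) (ρ : M →ₗ[A] M ⊗[A] C) :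
    M ⊗[A] C →ₗ[A] M :=
  (TensorProduct.rid A M).toLinearMap
    ∘ₗ LinearMap.lTensor M γ
    ∘ₗ (TensorProduct.assoc A M C C).toLinearMap
    ∘ₗ LinearMap.rTensor C ρ

/-- the induced action of `C` on a right `C`-comodule `M` is
associative over the cointegral product: `(m · c) · c' = m · (c * c')`. -/
theorem comodAct_assoc (γ : C ⊗[A] C →ₗ[A] A)
    (hcol : ∀ c c' : C, cointMulL γ (c ⊗ₜ[A] c') = cointMulR γ (c ⊗ₜ[A] c'))
    (hnorm : ∀ c : C, γ (Coalgebra.comul c) = Coalgebra.counit c)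
    (ρ : M →ₗ[A] M ⊗[A] C)
    (hcoassoc : ∀ m : M,
      (TensorProduct.assoc A M C C) (LinearMap.rTensor C ρ (ρ m)) =
        LinearMap.lTensor M Coalgebra.comul (ρ m))
    (hcounit : ∀ m : M,
      (TensorProduct.rid A M) (LinearMap.lTensor M Coalgebra.counit (ρ m)) = m) :
    ∀ (m : M) (c c' : C),
      comodAct γ ρ ((comodAct γ ρ (m ⊗ₜ[A] c)) ⊗ₜ[A] c') =
        comodAct γ ρ (m ⊗ₜ[A] cointMulL γ (c ⊗ₜ[A] c')) := by
  intro m c c'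
  have key : ∀ x : C, γ (x ⊗ₜ[A] cointMulL γ (c ⊗ₜ[A] c')) =
      γ (cointMulR γ (x ⊗ₜ[A] c) ⊗ₜ[A] c') := by
    intro x
    rw [← hcol x c, hcol c c']
    simp only [cointMulL, cointMulR, LinearMap.comp_apply, LinearEquiv.coe_coe,
      LinearMap.rTensor_tmul, LinearMap.lTensor_tmul]
    generalize (Coalgebra.comul c : C ⊗[A] C) = t
    induction t using TensorProduct.induction_on with
    | zero => simp
    | tmul a b => simp [← TensorProduct.smul_tmul', mul_comm]
    | add a b ha hb => simp only [TensorProduct.add_tmul, TensorProduct.tmul_add, map_add, ha, hb]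
  let φ : C ⊗[A] C →ₗ[A] A :=
    γ ∘ₗ ((TensorProduct.mk A C C).flip c') ∘ₗ (TensorProduct.rid A C).toLinearMap
      ∘ₗ LinearMap.lTensor C γ ∘ₗ (TensorProduct.assoc A C C C).toLinearMap
      ∘ₗ ((TensorProduct.mk A (C ⊗[A] C) C).flip c)
  have hφ : ∀ x y : C, φ (x ⊗ₜ[A] y) = γ (y ⊗ₜ[A] c) * γ (x ⊗ₜ[A] c') := by
    intro x y
    simp [φ, ← TensorProduct.smul_tmul']
  have hφΔ : ∀ x : C, φ (Coalgebra.comul x) = γ (cointMulR γ (x ⊗ₜ[A] c) ⊗ₜ[A] c') := by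
    intro x
    simp [φ, cointMulR]
  have hR : ∀ t : M ⊗[A] C, ∀ d : C, d = cointMulL γ (c ⊗ₜ[A] c') →
      (TensorProduct.rid A M) (LinearMap.lTensor M γ
        ((TensorProduct.assoc A M C C) (t ⊗ₜ[A] d))) =
      (TensorProduct.rid A M) (LinearMap.lTensor M φ
        (LinearMap.lTensor M Coalgebra.comul t)) := by
    intro t d hd
    induction t using TensorProduct.induction_on with
    | zero => simp
    | tmul a x =>
      simp only [TensorProduct.assoc_tmul, LinearMap.lTensor_tmul, TensorProduct.rid_tmul, hφΔ,
        hd, key]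
    | add a b ha hb => simp only [TensorProduct.add_tmul, map_add, ha, hb]
  have hL0 : ∀ (s : M ⊗[A] C) (y : C),
      γ (y ⊗ₜ[A] c) • (TensorProduct.rid A M) (LinearMap.lTensor M γ
        ((TensorProduct.assoc A M C C) (s ⊗ₜ[A] c'))) =
      (TensorProduct.rid A M) (LinearMap.lTensor M φ
        ((TensorProduct.assoc A M C C) (s ⊗ₜ[A] y))) := by
    intro s y
    induction s using TensorProduct.induction_on with
    | zero => simp
    | tmul a x =>
      simp only [TensorProduct.assoc_tmul, LinearMap.lTensor_tmul, TensorProduct.rid_tmul, hφ,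
        mul_smul]
    | add a b ha hb => simp only [TensorProduct.add_tmul, map_add, smul_add, ha, hb]
  have hL : ∀ t : M ⊗[A] C,
      comodAct γ ρ (((TensorProduct.rid A M) (LinearMap.lTensor M γ
        ((TensorProduct.assoc A M C C) (t ⊗ₜ[A] c)))) ⊗ₜ[A] c') =
      (TensorProduct.rid A M) (LinearMap.lTensor M φ
        ((TensorProduct.assoc A M C C) (LinearMap.rTensor C ρ t))) := by
    intro t
    induction t using TensorProduct.induction_on with
    | zero => simp
    | tmul a y =>
      simp only [TensorProduct.assoc_tmul, LinearMap.lTensor_tmul, TensorProduct.rid_tmul,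
        LinearMap.rTensor_tmul, ← hL0, ← TensorProduct.smul_tmul', map_smul]
      rfl
    | add a b ha hb => simp only [TensorProduct.add_tmul, map_add, ha, hb]
  have h1 := hL (ρ m)
  rw [hcoassoc, ← hR (ρ m) _ rfl] at h1
  exact h1
end

section
/- Let γ be a cointegral on C and let (M, ρ) be a right C-comodule. Then the induced action map M ⊗[A] C → M, m ⊗ c ↦ m · c, is a retraction of the coaction ρ: for all m ∈ M, Σ m₍₀₎ · m₍₁₎ = m. -/
open TensorProduct

variable {A C : Type*} [CommRing A] [AddCommGroup C] [Module A C] [Coalgebra A C]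

variable {M : Type*} [AddCommGroup M] [Module A M]

/-- the induced action map is a retraction of the coaction:
`Σ m₍₀₎ · m₍₁₎ = m` for all `m ∈ M`. -/
theorem comodAct_retraction (γ : C ⊗[A] C →ₗ[A] A)
    (hcol : ∀ c c' : C, cointMulL γ (c ⊗ₜ[A] c') = cointMulR γ (c ⊗ₜ[A] c'))
    (hnorm : ∀ c : C, γ (Coalgebra.comul c) = Coalgebra.counit c)
    (ρ : M →ₗ[A] M ⊗[A] C)
    (hcoassoc : ∀ m : M,
      (TensorProduct.assoc A M C C) (LinearMap.rTensor C ρ (ρ m)) =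
        LinearMap.lTensor M Coalgebra.comul (ρ m))
    (hcounit : ∀ m : M,
      (TensorProduct.rid A M) (LinearMap.lTensor M Coalgebra.counit (ρ m)) = m) :
    ∀ m : M, comodAct γ ρ (ρ m) = m := by
  intro m
  have h : γ ∘ₗ Coalgebra.comul = (Coalgebra.counit : C →ₗ[A] A) := LinearMap.ext hnorm
  simp only [comodAct, LinearMap.comp_apply, LinearEquiv.coe_coe]
  rw [hcoassoc, ← LinearMap.comp_apply (LinearMap.lTensor M γ), ← LinearMap.lTensor_comp, h]
  exact hcounit m
end

section
/- Let γ be a cointegral on C and let (M, ρ) be a right C-comodule. Then the induced action is a comodule map: for all m ∈ M and c ∈ C, ρ(m · c) = Σ (m · c₍₁₎) ⊗ c₍₂₎. -/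
open TensorProduct

variable {A C : Type*} [CommRing A] [AddCommGroup C] [Module A C] [Coalgebra A C]

variable {M : Type*} [AddCommGroup M] [Module A M]

/-- the induced action is a comodule map:
`ρ(m · c) = Σ (m · c₍₁₎) ⊗ c₍₂₎` for all `m ∈ M`, `c ∈ C`. -/
theorem comodAct_comodule_map (γ : C ⊗[A] C →ₗ[A] A)
    (hcol : ∀ c c' : C, cointMulL γ (c ⊗ₜ[A] c') = cointMulR γ (c ⊗ₜ[A] c'))
    (hnorm : ∀ c : C, γ (Coalgebra.comul c) = Coalgebra.counit c)
    (ρ : M →ₗ[A] M ⊗[A] C)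
    (hcoassoc : ∀ m : M,
      (TensorProduct.assoc A M C C) (LinearMap.rTensor C ρ (ρ m)) =
        LinearMap.lTensor M Coalgebra.comul (ρ m))
    (hcounit : ∀ m : M,
      (TensorProduct.rid A M) (LinearMap.lTensor M Coalgebra.counit (ρ m)) = m) :
    ∀ (m : M) (c : C),
      ρ (comodAct γ ρ (m ⊗ₜ[A] c)) =
        LinearMap.rTensor C (comodAct γ ρ)
          ((TensorProduct.assoc A M C C).symm (m ⊗ₜ[A] Coalgebra.comul c)) := by
  intro m c
  -- `G (d ⊗ e) = γ (e ⊗ c) • d`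
  let G : C ⊗[A] C →ₗ[A] C := (TensorProduct.rid A C).toLinearMap
    ∘ₗ LinearMap.lTensor C γ ∘ₗ (TensorProduct.assoc A C C C).toLinearMap
    ∘ₗ (TensorProduct.mk A (C ⊗[A] C) C).flip c
  have hG : ∀ d e : C, G (d ⊗ₜ[A] e) = γ (e ⊗ₜ[A] c) • d := by
    intro d e
    simp [G]
  have h1 : ∀ t : M ⊗[A] C,
      ρ ((TensorProduct.rid A M) (LinearMap.lTensor M γ
        ((TensorProduct.assoc A M C C) (t ⊗ₜ[A] c)))) =
      LinearMap.lTensor M G ((TensorProduct.assoc A M C C) (LinearMap.rTensor C ρ t)) := by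
    intro t
    induction t with
    | zero => simp
    | add x y hx hy => simp only [TensorProduct.add_tmul, map_add, hx, hy]
    | tmul n d =>
      simp only [TensorProduct.assoc_tmul, LinearMap.lTensor_tmul, TensorProduct.rid_tmul,
        LinearMap.rTensor_tmul, map_smul]
      generalize ρ n = u
      induction u with
      | zero => simp
      | add x y hx hy => simp only [TensorProduct.add_tmul, map_add, smul_add, hx, hy]
      | tmul a b =>
        simp only [TensorProduct.assoc_tmul, LinearMap.lTensor_tmul, hG,
          TensorProduct.tmul_smul]
  have h2 : ∀ d : C, G (Coalgebra.comul d) = cointMulL γ (d ⊗ₜ[A] c) := by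
    intro d
    rw [hcol]
    simp [G, cointMulR]
  have h3 : ∀ t : M ⊗[A] C, LinearMap.lTensor M G (LinearMap.lTensor M Coalgebra.comul t) =
      LinearMap.lTensor M (cointMulL γ ∘ₗ (TensorProduct.mk A C C).flip c) t := by
    intro t
    rw [← LinearMap.lTensor_comp_apply]
    congr 2
    ext d
    simp [h2]
  have h4 : LinearMap.lTensor M (cointMulL γ ∘ₗ (TensorProduct.mk A C C).flip c) (ρ m) =
      LinearMap.rTensor C (comodAct γ ρ)
        ((TensorProduct.assoc A M C C).symm (m ⊗ₜ[A] Coalgebra.comul c)) := by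
    have h5 : ∀ (y : C ⊗[A] C), LinearMap.rTensor C (comodAct γ ρ)
        ((TensorProduct.assoc A M C C).symm (m ⊗ₜ[A] y)) =
        LinearMap.lTensor M ((TensorProduct.lid A C).toLinearMap ∘ₗ LinearMap.rTensor C γ ∘ₗ
          (TensorProduct.assoc A C C C).symm.toLinearMap ∘ₗ
          (TensorProduct.mk A C (C ⊗[A] C)).flip y) (ρ m) := by
      intro y
      induction y with
      | zero => simp
      | add x y hx hy =>
        simp only [TensorProduct.tmul_add, map_add, hx, hy, LinearMap.comp_add,
          LinearMap.lTensor_add, LinearMap.add_apply]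
      | tmul a b =>
        simp only [TensorProduct.assoc_symm_tmul, LinearMap.rTensor_tmul, comodAct,
          LinearMap.comp_apply, LinearEquiv.coe_coe]
        generalize ρ m = u
        induction u with
        | zero => simp
        | add x y hx hy => simp only [TensorProduct.add_tmul, map_add, hx, hy]
        | tmul n d => simp [TensorProduct.smul_tmul]
    rw [h5]
    congr 2
  rw [← h4, ← h3, ← hcoassoc, ← h1]
  simp [comodAct]
end

section
/- Let A be a commutative ring and B a non-unital (associative) ring that is also an A-module whose multiplication is A-bilinear, with induced product map μ : B ⊗[A] B → B. Suppose Δ : B → B ⊗[A] B is an A-linear map such that μ ∘ Δ = id_B and Δ is a B-bimodule map, i.e. for all b, b' ∈ B: Δ(b b') = (L_b ⊗ id)(Δ(b')) and Δ(b b') = (id ⊗ R_{b'})(Δ(b)), where L_b is left multiplication by b and R_{b'} is right multiplication by b'. Then Δ is coassociative: (Δ ⊗ id) ∘ Δ = (id ⊗ Δ) ∘ Δ. Hence B is a (coseparable) non-counital A-coring with coproduct Δ. -/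
open TensorProduct

/-- if `B` is a non-unital associative `A`-algebra whose product
map `μ : B ⊗[A] B → B` admits an `A`-linear section `Δ` which is a
`B`-bimodule map, then `Δ` is coassociative; hence `B` is a (coseparable)
non-counital `A`-coring with coproduct `Δ`. -/
theorem section_coassoc {A B : Type*} [CommRing A] [NonUnitalRing B]
    [Module A B] [SMulCommClass A B B] [IsScalarTower A B B]
    (Δ : B →ₗ[A] B ⊗[A] B)
    (hsec : ∀ b : B, LinearMap.mul' A B (Δ b) = b)
    (hleft : ∀ b b' : B,
      Δ (b * b') = LinearMap.rTensor B (LinearMap.mulLeft A b) (Δ b'))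
    (hright : ∀ b b' : B,
      Δ (b * b') = LinearMap.lTensor B (LinearMap.mulRight A b') (Δ b)) :
    ∀ b : B,
      (TensorProduct.assoc A B B B) (LinearMap.rTensor B Δ (Δ b)) =
        LinearMap.lTensor B Δ (Δ b) := by
  let M : B ⊗[A] B →ₗ[A] B →ₗ[A] B ⊗[A] B :=
    ((LinearMap.rTensorHom B) ∘ₗ (LinearMap.mul A B)).flip
  have hM : ∀ t x, M t x = LinearMap.rTensor B (LinearMap.mulLeft A x) t := fun t x => rfl
  have h1 : ∀ x y, LinearMap.lTensor B Δ (Δ (x * y)) = LinearMap.lTensor B (M (Δ y)) (Δ x) := by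
    intro x y
    have h : Δ ∘ₗ LinearMap.mulRight A y = M (Δ y) := by
      ext z
      rw [hM, ← hleft]
      rfl
    rw [hright, ← LinearMap.lTensor_comp_apply, h]
  have h3 : ∀ (p q : B) (s : B ⊗[A] B),
      (TensorProduct.assoc A B B B) (LinearMap.lTensor B (LinearMap.mulRight A p) s ⊗ₜ[A] q) =
        LinearMap.lTensor B (M (p ⊗ₜ[A] q)) s := by
    intro p q s
    induction s using TensorProduct.induction_on with
    | zero => simp
    | tmul a b => simp [hM]
    | add a b ha hb => rw [map_add, TensorProduct.add_tmul, map_add, ha, hb, map_add]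
  have h2 : ∀ (x : B) (t : B ⊗[A] B), (TensorProduct.assoc A B B B)
      (LinearMap.rTensor B Δ (LinearMap.rTensor B (LinearMap.mulLeft A x) t)) =
        LinearMap.lTensor B (M t) (Δ x) := by
    intro x t
    induction t using TensorProduct.induction_on with
    | zero => simp
    | tmul p q =>
      rw [LinearMap.rTensor_tmul, LinearMap.rTensor_tmul, LinearMap.mulLeft_apply, hright, h3]
    | add a b ha hb =>
      rw [map_add, map_add, map_add, ha, hb, map_add, LinearMap.lTensor_add, LinearMap.add_apply]
  have h4 : ∀ s : B ⊗[A] B,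
      (TensorProduct.assoc A B B B) (LinearMap.rTensor B Δ (Δ (LinearMap.mul' A B s))) =
        LinearMap.lTensor B Δ (Δ (LinearMap.mul' A B s)) := by
    intro s
    induction s using TensorProduct.induction_on with
    | zero => simp
    | tmul x y => rw [LinearMap.mul'_apply, h1, hleft, h2]
    | add a b ha hb => simp only [map_add, ha, hb]
  intro b
  have h := h4 (Δ b)
  rwa [hsec] at h
end

section
/- Let γ be a cointegral on C and g ∈ C a grouplike element. Define Q := { q ∈ C | for all c ∈ C, q * c = γ(g ⊗ c) • q }. Then g ∈ Q, Q is closed under the cointegral product, and g is a right unit for Q: for all q ∈ Q, q * g = q. -/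
open TensorProduct

variable {A C : Type*} [CommRing A] [AddCommGroup C] [Module A C] [Coalgebra A C]

/-- `Q = { q ∈ C | ∀ c, q * c = γ(g ⊗ c) • q }`, where `*` denotes the
cointegral product. -/
noncomputable def Qset (γ : C ⊗[A] C →ₗ[A] A) (g : C) : Set C :=
  {q : C | ∀ c : C, cointMulL γ (q ⊗ₜ[A] c) = γ (g ⊗ₜ[A] c) • q}

/-- `g ∈ Q`, `Q` is closed under the cointegral product, and `g`
is a right unit for `Q`. -/
theorem Qset_subring_right_unit (γ : C ⊗[A] C →ₗ[A] A)
    (hcol : ∀ c c' : C, cointMulL γ (c ⊗ₜ[A] c') = cointMulR γ (c ⊗ₜ[A] c'))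
    (hnorm : ∀ c : C, γ (Coalgebra.comul c) = Coalgebra.counit c)
    (g : C) (hg : Coalgebra.comul g = g ⊗ₜ[A] g) (hg' : Coalgebra.counit g = (1 : A)) :
    g ∈ Qset γ g ∧
    (∀ q q' : C, q ∈ Qset γ g → q' ∈ Qset γ g → cointMulL γ (q ⊗ₜ[A] q') ∈ Qset γ g) ∧
    (∀ q : C, q ∈ Qset γ g → cointMulL γ (q ⊗ₜ[A] g) = q) := by
  refine ⟨fun c => ?_, fun q q' hq hq' c => ?_, fun q hq => ?_⟩
  · rw [hcol]
    simp [cointMulR, hg]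
  · rw [hq q', ← TensorProduct.smul_tmul', map_smul, hq c, smul_comm]
  · rw [hq g, ← hg, hnorm, hg', one_smul]
end

section
/- Let γ be a cointegral on C and g ∈ C a grouplike element. Define an action of C on A by a · c := γ((a • g) ⊗ c) for a ∈ A, c ∈ C. Then this action is associative over the cointegral product: for all a ∈ A and c, c' ∈ C, (a · c) · c' = a · (c * c'). -/
open TensorProduct

variable {A C : Type*} [CommRing A] [AddCommGroup C] [Module A C] [Coalgebra A C]

/-- the action `a · c := γ((a • g) ⊗ c)` of `C` on `A` is
associative over the cointegral product. -/
theorem base_action_assoc (γ : C ⊗[A] C →ₗ[A] A)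
    (hcol : ∀ c c' : C, cointMulL γ (c ⊗ₜ[A] c') = cointMulR γ (c ⊗ₜ[A] c'))
    (hnorm : ∀ c : C, γ (Coalgebra.comul c) = Coalgebra.counit c)
    (g : C) (hg : Coalgebra.comul g = g ⊗ₜ[A] g) (hg' : Coalgebra.counit g = (1 : A)) :
    ∀ (a : A) (c c' : C),
      γ (((γ ((a • g) ⊗ₜ[A] c)) • g) ⊗ₜ[A] c') =
        γ ((a • g) ⊗ₜ[A] cointMulL γ (c ⊗ₜ[A] c')) := by
  intro a c c'
  have key : ∀ t : C ⊗[A] C,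
      γ ((TensorProduct.lid A C (LinearMap.rTensor C γ
        ((TensorProduct.assoc A C C C).symm (g ⊗ₜ[A] t)))) ⊗ₜ[A] c') =
      γ (g ⊗ₜ[A] (TensorProduct.rid A C (LinearMap.lTensor C γ
        (TensorProduct.assoc A C C C (t ⊗ₜ[A] c'))))) := by
    intro t
    induction t with
    | zero => simp
    | tmul x y =>
      simp [← TensorProduct.smul_tmul', TensorProduct.tmul_smul, mul_comm]
    | add x y hx hy =>
      simp only [TensorProduct.tmul_add, TensorProduct.add_tmul, map_add, hx, hy]
  have h1 : TensorProduct.lid A C (LinearMap.rTensor C γ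
      ((TensorProduct.assoc A C C C).symm (g ⊗ₜ[A] Coalgebra.comul c))) =
      γ (g ⊗ₜ[A] c) • g := by
    have h := hcol g c
    simpa [cointMulL, cointMulR, hg] using h
  have h2 : TensorProduct.rid A C (LinearMap.lTensor C γ
      (TensorProduct.assoc A C C C (Coalgebra.comul c ⊗ₜ[A] c'))) =
      cointMulL γ (c ⊗ₜ[A] c') := by
    rw [hcol]
    simp [cointMulR]
  have h3 := key (Coalgebra.comul c)
  rw [h1, h2] at h3
  simp only [← TensorProduct.smul_tmul', map_smul, smul_eq_mul] at h3 ⊢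
  rw [← h3, mul_assoc]
end

section
/- Let γ be a cointegral on C and g ∈ C a grouplike element which is a left unit for the cointegral product, i.e. g * c = c for all c ∈ C. Then γ(g ⊗ c) = ε(c) for all c ∈ C, and every element of C is an A-multiple of g: c = ε(c) • g for all c ∈ C. -/
open TensorProduct

variable {A C : Type*} [CommRing A] [AddCommGroup C] [Module A C] [Coalgebra A C]

/-- if the grouplike element `g` is a left unit for the
cointegral product, then `γ(g ⊗ c) = ε(c)` and `c = ε(c) • g` for all `c`. -/
theorem grouplike_left_unit (γ : C ⊗[A] C →ₗ[A] A)
    (hcol : ∀ c c' : C, cointMulL γ (c ⊗ₜ[A] c') = cointMulR γ (c ⊗ₜ[A] c'))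
    (hnorm : ∀ c : C, γ (Coalgebra.comul c) = Coalgebra.counit c)
    (g : C) (hg : Coalgebra.comul g = g ⊗ₜ[A] g) (hg' : Coalgebra.counit g = (1 : A))
    (hunit : ∀ c : C, cointMulL γ (g ⊗ₜ[A] c) = c) :
    (∀ c : C, γ (g ⊗ₜ[A] c) = Coalgebra.counit c) ∧
    (∀ c : C, c = (Coalgebra.counit (R := A) c) • g) := by
  have key : ∀ c : C, c = γ (g ⊗ₜ[A] c) • g := by
    intro c
    have h := hunit c
    rw [hcol] at h
    simpa [cointMulR, hg] using h.symm
  have h1 : ∀ c : C, γ (g ⊗ₜ[A] c) = Coalgebra.counit c := by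
    intro c
    have h := congrArg (Coalgebra.counit (R := A)) (key c)
    rw [map_smul, hg', smul_eq_mul, mul_one] at h
    exact h.symm
  exact ⟨h1, fun c => by rw [← h1 c]; exact key c⟩
end

section
/- Let B be a commutative ring, A a B-algebra, and E : A → B a B-linear map. Then the E-multiplication on A ⊗[B] A, defined on simple tensors by (a ⊗ a') * (a'' ⊗ a''') = (a · E(a' a'')) ⊗ a''', extends to a well-defined B-bilinear product which is associative. -/
open TensorProduct

variable {B A : Type*} [CommRing B] [Ring A] [Algebra B A]

/-- The `E`-multiplication on `A ⊗[B] A`, as a `B`-linear map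
`(A ⊗[B] A) ⊗[B] (A ⊗[B] A) → A ⊗[B] A`; on simple tensors
`(a ⊗ a') ⊗ (a'' ⊗ a''') ↦ (a · E(a' a'')) ⊗ a'''`. -/
noncomputable def eMul (E : A →ₗ[B] B) :
    (A ⊗[B] A) ⊗[B] (A ⊗[B] A) →ₗ[B] A ⊗[B] A :=
  LinearMap.lTensor A
      ((TensorProduct.lid B A).toLinearMap
        ∘ₗ LinearMap.rTensor A (E ∘ₗ LinearMap.mul' B A)
        ∘ₗ (TensorProduct.assoc B A A A).symm.toLinearMap)
    ∘ₗ (TensorProduct.assoc B A A (A ⊗[B] A)).toLinearMap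

/-- the `E`-multiplication is a well-defined `B`-bilinear
product on `A ⊗[B] A`, given on simple tensors by
`(a ⊗ a') * (a'' ⊗ a''') = (a · E(a' a'')) ⊗ a'''`, and it is associative. -/
theorem eMul_tmul_and_assoc (E : A →ₗ[B] B) :
    (∀ a a' a'' a''' : A,
      eMul E ((a ⊗ₜ[B] a') ⊗ₜ[B] (a'' ⊗ₜ[B] a''')) =
        (E (a' * a'') • a) ⊗ₜ[B] a''') ∧
    (∀ x y z : A ⊗[B] A,
      eMul E ((eMul E (x ⊗ₜ[B] y)) ⊗ₜ[B] z) =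
        eMul E (x ⊗ₜ[B] (eMul E (y ⊗ₜ[B] z)))) := by
  have key : ∀ a b c d : A,
      eMul E ((a ⊗ₜ[B] b) ⊗ₜ[B] (c ⊗ₜ[B] d)) =
        (E (b * c) • a) ⊗ₜ[B] d := by
    intro a b c d
    simp [eMul, TensorProduct.smul_tmul]
  refine ⟨key, fun x y z => ?_⟩
  induction x with
  | zero => simp
  | add x₁ x₂ h₁ h₂ => simp only [TensorProduct.add_tmul, map_add, h₁, h₂]
  | tmul a b =>
    induction y with
    | zero => simp
    | add y₁ y₂ h₁ h₂ =>
      simp only [TensorProduct.add_tmul, TensorProduct.tmul_add, map_add, h₁, h₂]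
    | tmul c d =>
      induction z with
      | zero => simp
      | add z₁ z₂ h₁ h₂ => simp only [TensorProduct.tmul_add, map_add, h₁, h₂]
      | tmul e f =>
        simp only [key, mul_smul_comm, map_smul, smul_smul, smul_eq_mul]
end

section
/- Let B be a commutative ring, A a B-algebra, and e = Σᵢ e¹ᵢ ⊗ e²ᵢ ∈ A ⊗[B] A a Casimir element, i.e. Σᵢ (a e¹ᵢ) ⊗ e²ᵢ = Σᵢ e¹ᵢ ⊗ (e²ᵢ a) for all a ∈ A. Then the product on B-linear endomorphisms of A defined by (α * β)(x) := Σᵢ α(x e¹ᵢ) β(e²ᵢ), for α, β ∈ End_B(A) and x ∈ A, is associative. -/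
open TensorProduct

/-- The product induced by a (Casimir) element `e = Σᵢ e¹ᵢ ⊗ e²ᵢ`:
`(α * β)(x) = Σᵢ α(x e¹ᵢ) β(e²ᵢ)`, defined here on arbitrary functions. -/
def casimirMul {A : Type*} [Ring A] {n : ℕ} (e1 e2 : Fin n → A)
    (f g : A → A) : A → A :=
  fun x => ∑ i, f (x * e1 i) * g (e2 i)

/-- for a Casimir element `e = Σᵢ e¹ᵢ ⊗ e²ᵢ ∈ A ⊗[B] A`, the
product `(α * β)(x) = Σᵢ α(x e¹ᵢ) β(e²ᵢ)` on `End_B(A)` is associative. -/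
theorem casimirMul_assoc {B A : Type*} [CommRing B] [Ring A] [Algebra B A]
    {n : ℕ} (e1 e2 : Fin n → A)
    (hCasimir : ∀ a : A,
      ∑ i, (a * e1 i) ⊗ₜ[B] e2 i = ∑ i, e1 i ⊗ₜ[B] (e2 i * a))
    (α β δ : Module.End B A) :
    casimirMul e1 e2 (casimirMul e1 e2 ⇑α ⇑β) ⇑δ =
      casimirMul e1 e2 ⇑α (casimirMul e1 e2 ⇑β ⇑δ) := by
  funext x
  have key : ∀ a : A, ∑ j, α (x * (a * e1 j)) * β (e2 j) =
      ∑ j, α (x * e1 j) * β (e2 j * a) := by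
    intro a
    have h := congrArg (TensorProduct.lift
      ((LinearMap.mul B A).compl₁₂ (α ∘ₗ LinearMap.mulLeft B x) β)) (hCasimir a)
    simpa using h
  simp only [casimirMul, mul_assoc x, ← Finset.sum_mul, key]
  simp only [Finset.sum_mul, Finset.mul_sum]
  rw [Finset.sum_comm]
  simp only [mul_assoc]
end
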